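/- arXiv:1305.3449 — 2 statements merged into one kernel-verified Lean document; each statement's English description precedes it below -/
import Mathlib

section
/- Let q = e[xx,00] + e[xx,01] ∈ L. Define ρ, σ₁, σ₂ ∈ S by: ρ(00|xx)=ρ(00|xy)=ρ(00|yx)=1/2, ρ(01|yy)=ρ(10|yy)=1/2, ρ(11|xx)=ρ(11|xy)=ρ(11|yx)=1/2, and all other values 0; σ₁(00|ab)=1 for all a,b and all other values 0; σ₂(00|xx)=σ₂(00|xy)=1, σ₂(10|yx)=σ₂(10|yy)=1, and all other values 0. Then ρ, σ₁, σ₂ are (2,2)-box states, σ₁ ≠ σ₂, q(ρ) = 1/2, and for i = 1,2 and every f ∈ L with f ≤ q pointwise on S one has f(σᵢ) = f(ρ)/q(ρ). Hence both σ₁ and σ₂ are conditional probabilities of ρ under q, so the propositional system of the (2,2)-box world is not a unique conditional probability space. -/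
namespace BoxWorld

/-- A (2,2)-box assignment: `P a b α β` stands for `P(αβ|ab)`, where the measurement
settings are `a, b ∈ Fin 2` (with `x = 0`, `y = 1`) and the outcomes are `α, β ∈ Fin 2`. -/
abbrev Box : Type := Fin 2 → Fin 2 → Fin 2 → Fin 2 → ℝ

/-- (P1) positivity, (P2) normalization, (P3) non-signalling. -/
def IsState (P : Box) : Prop :=
  (∀ a b α β, 0 ≤ P a b α β) ∧
  (∀ a b, ∑ α : Fin 2, ∑ β : Fin 2, P a b α β = 1) ∧
  (∀ a b b' α, ∑ β : Fin 2, P a b α β = ∑ β : Fin 2, P a b' α β) ∧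
  (∀ a a' b β, ∑ α : Fin 2, P a b α β = ∑ α : Fin 2, P a' b α β)

/-- The set `S` of (2,2)-box states, as a subtype. -/
abbrev State : Type := {P : Box // IsState P}

/-- The elementary question `e[ab, αβ]`, as a functional on states. -/
def elem (a b α β : Fin 2) : State → ℝ := fun P => P.1 a b α β

abbrev Idx : Type := Fin 2 × Fin 2 × Fin 2 × Fin 2

def elemI (i : Idx) : State → ℝ := elem i.1 i.2.1 i.2.2.1 i.2.2.2

/-- The logic `L` of the (2,2)-box world: all functionals `f = Σ_{e ∈ A} e`, where `A` is a
set of elementary questions whose pointwise sum is `≤ 1` at every state, together with the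
complements `1 - f` of all such functionals. -/
def InLogic (f : State → ℝ) : Prop :=
  (∃ A : Finset Idx, (∀ P : State, ∑ i ∈ A, elemI i P ≤ 1) ∧
      f = fun P => ∑ i ∈ A, elemI i P) ∨
  (∃ A : Finset Idx, (∀ P : State, ∑ i ∈ A, elemI i P ≤ 1) ∧
      f = fun P => 1 - ∑ i ∈ A, elemI i P)

/-- The question `q = e[xx,00] ⊕ e[xx,01]`. -/
def qFun : State → ℝ := fun P => P.1 0 0 0 0 + P.1 0 0 0 1

/-- The box `ρ`: `ρ(00|xx) = ρ(00|xy) = ρ(00|yx) = 1/2`, `ρ(11|xx) = ρ(11|xy) = ρ(11|yx) = 1/2`,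
`ρ(01|yy) = ρ(10|yy) = 1/2`, all other values `0`. -/
noncomputable def rhoFun : Box := fun a b α β =>
  if a = 1 ∧ b = 1 then (if α ≠ β then 1/2 else 0) else (if α = β then 1/2 else 0)

/-- The box `σ₁`: `σ₁(00|ab) = 1` for all `a, b`, all other values `0`. -/
def sigma1Fun : Box := fun _ _ α β => if α = 0 ∧ β = 0 then 1 else 0

/-- The box `σ₂`: `σ₂(00|xx) = σ₂(00|xy) = 1`, `σ₂(10|yx) = σ₂(10|yy) = 1`,
all other values `0`. -/
def sigma2Fun : Box := fun a _ α β =>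
  if a = 0 then (if α = 0 ∧ β = 0 then 1 else 0) else (if α = 1 ∧ β = 0 then 1 else 0)

/-- The deterministic box in which the outcomes are the functions `u`, `v` of the settings. -/
def detBox (u v : Fin 2 → Fin 2) : Box := fun a b α β => if α = u a ∧ β = v b then 1 else 0

lemma isState_detBox (u v : Fin 2 → Fin 2) : IsState (detBox u v) := by
  refine ⟨fun a b α β => ?_, fun a b => ?_, fun a b b' α => ?_, fun a a' b β => ?_⟩
  · unfold detBox
    split_ifs <;> norm_num
  all_goals simp [detBox, ite_and]

/-- The deterministic box as a state. -/
def detState (u v : Fin 2 → Fin 2) : State := ⟨detBox u v, isState_detBox u v⟩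

lemma sigma1Fun_eq_detBox : sigma1Fun = detBox ![0, 0] ![0, 0] := by
  funext a b α β
  fin_cases a <;> fin_cases b <;> fin_cases α <;> fin_cases β <;>
    simp [sigma1Fun, detBox]

lemma sigma2Fun_eq_detBox : sigma2Fun = detBox ![0, 1] ![0, 0] := by
  funext a b α β
  fin_cases a <;> fin_cases b <;> fin_cases α <;> fin_cases β <;>
    simp [sigma2Fun, detBox]

lemma isState_rhoFun : IsState rhoFun := by
  refine ⟨fun a b α β => ?_, fun a b => ?_, fun a b b' α => ?_, fun a a' b β => ?_⟩
  · unfold rhoFun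
    split_ifs <;> norm_num
  · fin_cases a <;> fin_cases b <;> norm_num [rhoFun, Fin.sum_univ_two]
  · fin_cases a <;> fin_cases b <;> fin_cases b' <;> fin_cases α <;>
      norm_num [rhoFun, Fin.sum_univ_two]
  · fin_cases a <;> fin_cases a' <;> fin_cases b <;> fin_cases β <;>
      norm_num [rhoFun, Fin.sum_univ_two]

lemma InLogic.nonneg {f : State → ℝ} (hf : InLogic f) (P : State) : 0 ≤ f P := by
  rcases hf with ⟨A, -, rfl⟩ | ⟨A, hA, rfl⟩
  · exact Finset.sum_nonneg fun i _ => P.2.1 _ _ _ _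
  · exact sub_nonneg.2 (hA P)

/-- Elements of the logic respect affine relations between states. -/
lemma InLogic.affine {f : State → ℝ} (hf : InLogic f) {ρ σ A B C : State}
    (h : ∀ a b α β, 2 * ρ.1 a b α β + B.1 a b α β =
      σ.1 a b α β + A.1 a b α β + C.1 a b α β) :
    2 * f ρ + f B = f σ + f A + f C := by
  have key (T : Finset Idx) : 2 * ∑ i ∈ T, elemI i ρ + ∑ i ∈ T, elemI i B =
      ∑ i ∈ T, elemI i σ + ∑ i ∈ T, elemI i A + ∑ i ∈ T, elemI i C := by
    simp only [Finset.mul_sum, ← Finset.sum_add_distrib]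
    exact Finset.sum_congr rfl fun i _ => h _ _ _ _
  rcases hf with ⟨T, -, rfl⟩ | ⟨T, -, rfl⟩
  · exact key T
  · linarith [key T]

/-- An element of the logic below `q` vanishes where Alice's outcome for `x` is surely `1`. -/
lemma InLogic.detState_eq_zero {f : State → ℝ} (hf : InLogic f) (hq : ∀ P, f P ≤ qFun P)
    {u : Fin 2 → Fin 2} (hu : u 0 = 1) (v : Fin 2 → Fin 2) : f (detState u v) = 0 := by
  refine le_antisymm ((hq _).trans_eq ?_) (hf.nonneg _)
  simp [qFun, detState, detBox, hu]

/-- `ρ, σ₁, σ₂` are (2,2)-box states, `σ₁ ≠ σ₂`, `q(ρ) = 1/2`, and both `σ₁`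
and `σ₂` are conditional probabilities of `ρ` under `q = e[xx,00] ⊕ e[xx,01]`; hence the
propositional system of the (2,2)-box world is not a unique conditional probability space. -/
theorem not_unique_conditional_probability_space :
    IsState rhoFun ∧ IsState sigma1Fun ∧ IsState sigma2Fun ∧ sigma1Fun ≠ sigma2Fun ∧
    (∀ ρ : State, ρ.1 = rhoFun →
      qFun ρ = 1/2 ∧
      (∀ σ : State, (σ.1 = sigma1Fun ∨ σ.1 = sigma2Fun) →
        ∀ f : State → ℝ, InLogic f → (∀ P : State, f P ≤ qFun P) →
          f σ = f ρ / qFun ρ)) := by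
  refine ⟨isState_rhoFun, sigma1Fun_eq_detBox ▸ isState_detBox _ _,
    sigma2Fun_eq_detBox ▸ isState_detBox _ _, fun h => ?_, fun ρ hρ => ?_⟩
  · simpa [sigma1Fun, sigma2Fun] using congrFun (congrFun (congrFun (congrFun h 1) 0) 0) 0
  have hqρ : qFun ρ = 1 / 2 := by simp [qFun, hρ, rhoFun]
  refine ⟨hqρ, fun σ hσ f hf hfq => ?_⟩
  have hzero (y : Fin 2) (v : Fin 2 → Fin 2) : f (detState ![1, y] v) = 0 :=
    hf.detState_eq_zero hfq rfl v
  suffices 2 * f ρ = f σ by rw [hqρ, ← this]; ring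
  rcases hσ with hσ | hσ
  · have := hf.affine (ρ := ρ) (σ := σ) (A := detState ![1, 1] ![1, 0])
      (B := detState ![1, 0] ![1, 0]) (C := detState ![1, 0] ![1, 1]) fun a b α β => by
        rw [hρ, hσ]
        fin_cases a <;> fin_cases b <;> fin_cases α <;> fin_cases β <;>
          norm_num [rhoFun, sigma1Fun, detState, detBox]
    simpa [hzero] using this
  · have := hf.affine (ρ := ρ) (σ := σ) (A := detState ![1, 0] ![0, 1])
      (B := detState ![1, 1] ![0, 1]) (C := detState ![1, 1] ![1, 1]) fun a b α β => by
        rw [hρ, hσ]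
        fin_cases a <;> fin_cases b <;> fin_cases α <;> fin_cases β <;>
          norm_num [rhoFun, sigma2Fun, detState, detBox]
    simpa [hzero] using this

end BoxWorld
end

section
/- For all α,β,γ,δ ∈ {0,1}, neither the pair (e[xx,αβ], e[yy,γδ]) nor the pair (e[xy,αβ], e[yx,γδ]) has a least upper bound in the poset (L, pointwise order): there is no h ∈ L with e[xx,αβ] ≤ h and e[yy,γδ] ≤ h pointwise on S such that h ≤ h' for every h' ∈ L that is an upper bound of both (and similarly for the second family of pairs). Consequently the logic L of the (2,2)-box world is not a lattice. -/
namespace BoxWorld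

/-- The deterministic state in which the two parties answer setting `s` with `f s`, `g s`. -/
def det (f g : Fin 2 → Fin 2) : State :=
  ⟨fun a b α β => if α = f a ∧ β = g b then 1 else 0,
    fun a b α β => by positivity,
    fun a b => by simp [ite_and],
    fun a b b' α => by simp [ite_and],
    fun a a' b β => by simp [ite_and]⟩

theorem elem_det (f g : Fin 2 → Fin 2) (a b α β : Fin 2) :
    elem a b α β (det f g) = if α = f a ∧ β = g b then 1 else 0 := rfl

theorem elem_nonneg (P : State) (a b α β : Fin 2) : 0 ≤ elem a b α β P :=
  P.2.1 a b α β

theorem elem_add_elem_fst_le_one (P : State) (a b b' : Fin 2) {α α' : Fin 2} (β β' : Fin 2)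
    (h : α ≠ α') : elem a b α β P + elem a b' α' β' P ≤ 1 := by
  obtain ⟨P, h0, h1, h2, -⟩ := P
  have n := h1 a b
  have e := h2 a b b' α'
  have p := h0 a b
  have p' := h0 a b' α'
  simp only [Fin.sum_univ_two, elem] at *
  have := p 0 0; have := p 0 1; have := p 1 0; have := p 1 1; have := p' 0; have := p' 1
  fin_cases α <;> fin_cases α' <;> fin_cases β <;> fin_cases β' <;> simp at * <;> linarith

theorem elem_add_elem_snd_le_one (P : State) (a a' b : Fin 2) (α α' : Fin 2) {β β' : Fin 2}
    (h : β ≠ β') : elem a b α β P + elem a' b α' β' P ≤ 1 := by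
  obtain ⟨P, h0, h1, -, h3⟩ := P
  have n := h1 a b
  have e := h3 a a' b β'
  have p := h0 a b
  have p' := fun x => h0 a' b x β'
  simp only [Fin.sum_univ_two, elem] at *
  have := p 0 0; have := p 0 1; have := p 1 0; have := p 1 1; have := p' 0; have := p' 1
  fin_cases α <;> fin_cases α' <;> fin_cases β <;> fin_cases β' <;> simp at * <;> linarith

theorem elem_le_one (P : State) (a b α β : Fin 2) : elem a b α β P ≤ 1 := by
  have hne : α ≠ 1 - α := by revert α; decide
  linarith [elem_add_elem_fst_le_one P a b b β 0 hne, elem_nonneg P a b (1 - α) 0]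

theorem inLogic_one_sub_elem (a b α β : Fin 2) : InLogic fun P => 1 - elem a b α β P :=
  Or.inr ⟨{(a, b, α, β)}, fun P => by simpa [elemI] using elem_le_one P a b α β,
    by simp [elemI]⟩

/-- If a sum of elementary questions is positive at a deterministic state but vanishes after
changing either party's answer at the settings `a`, `b`, then it contains the question on
`a, b` affirmed by that state. -/
theorem mem_of_sum_det {A : Finset Idx} {f f' g g' : Fin 2 → Fin 2} (a b : Fin 2)
    (hf : ∀ s, s ≠ a → f s = f' s) (hg : ∀ s, s ≠ b → g s = g' s)
    (h : 0 < ∑ i ∈ A, elemI i (det f g)) (h₁ : ∑ i ∈ A, elemI i (det f' g) ≤ 0)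
    (h₂ : ∑ i ∈ A, elemI i (det f g') ≤ 0) : (a, b, f a, g b) ∈ A := by
  have hz : ∀ P : State, ∑ i ∈ A, elemI i P ≤ 0 → ∀ i ∈ A, elemI i P = 0 := fun P hP =>
    (Finset.sum_eq_zero_iff_of_nonneg fun _ _ => elem_nonneg P _ _ _ _).1
      (hP.antisymm (Finset.sum_nonneg fun _ _ => elem_nonneg P _ _ _ _))
  obtain ⟨⟨c, d, α, β⟩, hi, hpos⟩ := Finset.exists_ne_zero_of_sum_ne_zero h.ne'
  have k₁ := hz _ h₁ _ hi
  have k₂ := hz _ h₂ _ hi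
  simp only [elemI, elem_det] at hpos k₁ k₂
  have hm : α = f c ∧ β = g d := by
    by_contra hc
    simp [hc] at hpos
  obtain ⟨rfl, rfl⟩ := hm
  have hc : c = a := by
    by_contra hc
    simp [hf c hc] at k₁
  have hd : d = b := by
    by_contra hd
    simp [hg d hd] at k₂
  exact hc ▸ hd ▸ hi

theorem elemI_add_elemI_le_sum {A : Finset Idx} {i j : Idx} (hij : i ≠ j) (hi : i ∈ A) (hj : j ∈ A)
    (P : State) : elemI i P + elemI j P ≤ ∑ k ∈ A, elemI k P := by
  rw [← Finset.sum_pair (f := fun k => elemI k P) hij]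
  exact Finset.sum_le_sum_of_subset_of_nonneg (by simp [Finset.insert_subset_iff, hi, hj])
    fun _ _ _ => elem_nonneg P _ _ _ _

/-- The answers of one party: `u` at the setting `a` and `v` at the other one. -/
def answers (a u v : Fin 2) : Fin 2 → Fin 2 := fun s => if s = a then u else v

theorem not_exists_lub_elem {a a' b b' : Fin 2} (ha : a' ≠ a) (hb : b' ≠ b) (α β γ δ : Fin 2) :
    ¬ ∃ h : State → ℝ, InLogic h ∧
      (∀ P : State, elem a b α β P ≤ h P) ∧ (∀ P : State, elem a' b' γ δ P ≤ h P) ∧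
      (∀ h' : State → ℝ, InLogic h' →
        (∀ P : State, elem a b α β P ≤ h' P) → (∀ P : State, elem a' b' γ δ P ≤ h' P) →
        ∀ P : State, h P ≤ h' P) := by
  rintro ⟨h, hL, hl, hl', hu⟩
  obtain ⟨α', hα⟩ := exists_ne α
  obtain ⟨β', hβ⟩ := exists_ne β
  obtain ⟨γ', hγ⟩ := exists_ne γ
  obtain ⟨δ', hδ⟩ := exists_ne δ
  have u₁ := hu _ (inLogic_one_sub_elem a b' α' δ')
    (fun P => by linarith [elem_add_elem_fst_le_one P a b b' β δ' hα.symm])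
    (fun P => by linarith [elem_add_elem_snd_le_one P a' a b' γ α' hδ.symm])
  have u₂ := hu _ (inLogic_one_sub_elem a' b γ' β')
    (fun P => by linarith [elem_add_elem_snd_le_one P a a' b α γ' hβ.symm])
    (fun P => by linarith [elem_add_elem_fst_le_one P a' b' b δ β' hγ.symm])
  let D := fun u v w z => det (answers a u v) (answers b w z)
  have l₁ : ∀ v z, 1 ≤ h (D α v β z) := fun v z => by
    simpa [D, elem_det, answers] using hl (D α v β z)
  have l₂ : ∀ u w, 1 ≤ h (D u γ w δ) := fun u w => by
    simpa [D, elem_det, answers, ha, hb] using hl' (D u γ w δ)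
  have z₁ : ∀ v w, h (D α' v w δ') ≤ 0 := fun v w => by
    simpa [D, elem_det, answers, ha, hb] using u₁ (D α' v w δ')
  have z₂ : ∀ u z, h (D u γ' β' z) ≤ 0 := fun u z => by
    simpa [D, elem_det, answers, ha, hb] using u₂ (D u γ' β' z)
  have fst : ∀ c u u' v s, s ≠ c → answers c u v s = answers c u' v s := by
    intro c u u' v s hs
    simp [answers, hs]
  have snd : ∀ {c c'} u v v' s, c' ≠ c → s ≠ c' → answers c u v s = answers c u v' s := by
    intro c c' u v v' s hc hs
    have : s = c := by omega
    simp [answers, this]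
  rcases hL with ⟨A, hA, rfl⟩ | ⟨A, hA, rfl⟩
  · have m₁ := mem_of_sum_det a b (fst a α α' γ') (fst b β β' δ')
      (one_pos.trans_le (l₁ γ' δ')) (z₁ γ' β) (z₂ α δ')
    have m₂ := mem_of_sum_det a' b' (fun s => snd α' γ γ' s ha) (fun s => snd β' δ δ' s hb)
      (one_pos.trans_le (l₂ α' β')) (z₂ α' δ) (z₁ γ β')
    have hs := elemI_add_elemI_le_sum (fun e => ha (congrArg Prod.fst e).symm) m₁ m₂ (D α γ β δ)
    have hle := hA (D α γ β δ)
    simp only [D, elemI, elem_det, answers, ha, hb, if_true, if_false, and_self] at hs hle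
    linarith
  · have m₁ := mem_of_sum_det a b' (fst a α' α γ) (fun s => snd β δ' δ s hb)
      (A := A) (by linarith [z₁ γ β]) (by linarith [l₁ γ δ']) (by linarith [l₂ α' β])
    have m₂ := mem_of_sum_det a' b (fun s => snd α γ' γ s ha) (fst b β' β δ)
      (A := A) (by linarith [z₂ α δ]) (by linarith [l₂ α β']) (by linarith [l₁ γ' δ])
    have hs := elemI_add_elemI_le_sum (fun e => ha (congrArg Prod.fst e).symm) m₁ m₂ (D α' γ' β' δ')
    have hle := hA (D α' γ' β' δ')
    simp only [D, elemI, elem_det, answers, ha, hb, if_true, if_false, and_self] at hs hle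
    linarith

/-- for all outcomes `α β γ δ`, neither the pair `(e[xx,αβ], e[yy,γδ])` nor
the pair `(e[xy,αβ], e[yx,γδ])` has a least upper bound in `L`; hence `L` is not a
lattice. -/
theorem no_least_upper_bound (α β γ δ : Fin 2) :
    (¬ ∃ h : State → ℝ, InLogic h ∧
        (∀ P : State, elem 0 0 α β P ≤ h P) ∧ (∀ P : State, elem 1 1 γ δ P ≤ h P) ∧
        (∀ h' : State → ℝ, InLogic h' →
          (∀ P : State, elem 0 0 α β P ≤ h' P) → (∀ P : State, elem 1 1 γ δ P ≤ h' P) →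
          ∀ P : State, h P ≤ h' P)) ∧
    (¬ ∃ h : State → ℝ, InLogic h ∧
        (∀ P : State, elem 0 1 α β P ≤ h P) ∧ (∀ P : State, elem 1 0 γ δ P ≤ h P) ∧
        (∀ h' : State → ℝ, InLogic h' →
          (∀ P : State, elem 0 1 α β P ≤ h' P) → (∀ P : State, elem 1 0 γ δ P ≤ h' P) →
          ∀ P : State, h P ≤ h' P)) :=
  ⟨not_exists_lub_elem (by decide) (by decide) α β γ δ,
    not_exists_lub_elem (by decide) (by decide) α β γ δ⟩

end BoxWorld
end
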